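/- arXiv:2512.06425 — 4 statements merged into one kernel-verified Lean document; each statement's English description precedes it below -/
import Mathlib

section
/- The bilateral weighted backward shift B_w on c₀(ℤ) is expansive if and only if sup_{n∈ℕ} |w_{−n} ⋯ w_{−1}| = ∞ or sup_{n∈ℕ} |w_1 ⋯ w_n|^{−1} = ∞. -/
open Filter Topology
open scoped ENNReal NNReal ZeroAtInfty

/-- A bilateral weight sequence without zeros is a ratio of consecutive terms of a sequence
without zeros. -/
theorem exists_weight_potential {𝕜 : Type*} [Field 𝕜] (w : ℤ → 𝕜) (hw : ∀ n, w n ≠ 0) :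
    ∃ u : ℤ → 𝕜, (∀ n, u n ≠ 0) ∧ (∀ n, u n = w n * u (n + 1)) ∧
      (∀ n : ℕ, u (-(n : ℤ)) = ∏ j ∈ Finset.Icc 1 n, w (-(j : ℤ))) ∧
      ∀ n : ℕ, w 0 * u (n + 1) = (∏ j ∈ Finset.Icc 1 n, w (j : ℤ))⁻¹ := by
  let u : ℤ → 𝕜 := fun m ↦ (∏ j ∈ Finset.range m.toNat, w (j : ℤ))⁻¹ *
    ∏ j ∈ Finset.Icc 1 (-m).toNat, w (-(j : ℤ))
  have hneg (n : ℕ) : u (-(n : ℤ)) = ∏ j ∈ Finset.Icc 1 n, w (-(j : ℤ)) := by simp [u]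
  have hpos (n : ℕ) : u n = (∏ j ∈ Finset.range n, w (j : ℤ))⁻¹ := by simp [u]
  refine ⟨u, fun n ↦ ?_, fun n ↦ ?_, hneg, fun n ↦ ?_⟩
  · exact mul_ne_zero (inv_ne_zero (Finset.prod_ne_zero_iff.2 fun _ _ ↦ hw _))
      (Finset.prod_ne_zero_iff.2 fun _ _ ↦ hw _)
  · rcases le_or_gt 0 n with h | h
    · lift n to ℕ using h
      rw [hpos, ← Nat.cast_succ, hpos, Nat.succ_eq_add_one, Finset.prod_range_succ, mul_inv_rev,
        mul_inv_cancel_left₀ (hw _)]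
    · obtain ⟨k, rfl⟩ : ∃ k : ℕ, n = -((k + 1 : ℕ) : ℤ) := ⟨(-n - 1).toNat, by omega⟩
      have hk : -((k + 1 : ℕ) : ℤ) + 1 = -(k : ℤ) := by push_cast; ring
      rw [hk, hneg, hneg, Finset.prod_Icc_succ_top (by omega), mul_comm]
  · rw [← Nat.cast_succ, hpos, Nat.succ_eq_add_one, Finset.prod_range_succ', mul_inv_rev,
      Nat.cast_zero, mul_inv_cancel_left₀ (hw _), ← Finset.Ico_add_one_right_eq_Icc,
      Finset.prod_Ico_eq_prod_range]
    simp [add_comm]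

/-- A family indexed by `ℤ` is bounded iff its two halves are. -/
theorem bddAbove_range_int_iff {α : Type*} [SemilatticeSup α] (f : ℤ → α) :
    BddAbove (Set.range f) ↔
      BddAbove (Set.range fun n : ℕ ↦ f (-(n : ℤ))) ∧
        BddAbove (Set.range fun n : ℕ ↦ f ((n : ℤ) + 1)) := by
  rw [← bddAbove_union]
  congr! 1
  ext y
  constructor
  · rintro ⟨n, rfl⟩
    rcases le_or_gt n 0 with h | h
    · exact .inl ⟨(-n).toNat, congrArg f (by omega)⟩
    · exact .inr ⟨(n - 1).toNat, congrArg f (by omega)⟩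
  · rintro (⟨n, rfl⟩ | ⟨n, rfl⟩) <;> exact ⟨_, rfl⟩

section Shift

variable {𝕜 : Type*} [RCLike 𝕜]

theorem zpow_weightedShift_apply_mul {w u : ℤ → 𝕜} (hw : ∀ n, w n ≠ 0)
    (hu : ∀ n, u n = w n * u (n + 1)) {T : C₀(ℤ, 𝕜) ≃L[𝕜] C₀(ℤ, 𝕜)}
    (hT : ∀ (x : C₀(ℤ, 𝕜)) (n : ℤ), T x n = w n * x (n + 1)) (k : ℤ) (x : C₀(ℤ, 𝕜)) (n : ℤ) :
    (T ^ k) x n * u (n + k) = u n * x (n + k) := by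
  induction k using Int.induction_on generalizing x with
  | zero =>
    rw [zpow_zero, add_zero]
    exact mul_comm _ _
  | succ k ih =>
    have h := ih (T x)
    rw [hT, hu (n + k), add_assoc] at h
    rw [zpow_add_one]
    refine mul_left_cancel₀ (hw (n + k)) ?_
    change w (n + k) * ((T ^ (k : ℤ)) (T x) n * _) = _
    linear_combination h
  | pred k ih =>
    have h := ih (T.symm x)
    have hx := hT (T.symm x) (n + (-(k : ℤ) - 1))
    have hk : n + (-(k : ℤ) - 1) + 1 = n + -(k : ℤ) := by ring
    rw [T.apply_symm_apply, hk] at hx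
    rw [hx, hu (n + (-(k : ℤ) - 1)), hk, zpow_sub_one]
    change (T ^ (-(k : ℤ))) (T.symm x) n * _ = _
    linear_combination w (n + (-(k : ℤ) - 1)) * h

theorem ZeroAtInftyContinuousMap.nnnorm_apply_le (x : C₀(ℤ, 𝕜)) (n : ℤ) : ‖x n‖₊ ≤ ‖x‖₊ :=
  x.toBCF.norm_coe_le_norm n

theorem ZeroAtInftyContinuousMap.nnnorm_le_of_apply_le {x : C₀(ℤ, 𝕜)} {C : ℝ≥0}
    (h : ∀ n, ‖x n‖₊ ≤ C) : ‖x‖₊ ≤ C :=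
  (BoundedContinuousFunction.norm_le (f := x.toBCF) C.2).2 h

theorem expansive_weightedShift_iff_not_bddAbove {w u : ℤ → 𝕜} (hw : ∀ n, w n ≠ 0)
    (hu₀ : ∀ n, u n ≠ 0) (hu : ∀ n, u n = w n * u (n + 1)) {T : C₀(ℤ, 𝕜) ≃L[𝕜] C₀(ℤ, 𝕜)}
    (hT : ∀ (x : C₀(ℤ, 𝕜)) (n : ℤ), T x n = w n * x (n + 1)) :
    (∀ x : C₀(ℤ, 𝕜), x ≠ 0 → ¬ BddAbove (Set.range fun n : ℤ ↦ ‖(T ^ n) x‖₊)) ↔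
      ¬ BddAbove (Set.range fun n ↦ ‖u n‖₊) := by
  have key := zpow_weightedShift_apply_mul hw hu hT
  constructor
  · rintro h ⟨C, hC⟩
    let e : C₀(ℤ, 𝕜) :=
      { toFun := Pi.single 0 1
        continuous_toFun := continuous_of_discreteTopology
        zero_at_infty' := by
          rw [cocompact_eq_cofinite]
          refine tendsto_const_nhds.congr' ?_
          filter_upwards [(Set.finite_singleton (0 : ℤ)).compl_mem_cofinite] with n hn
          exact (Pi.single_eq_of_ne (M := fun _ ↦ 𝕜) hn _).symm }
    have he (n : ℤ) : e n = Pi.single (M := fun _ ↦ 𝕜) 0 1 n := rfl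
    refine h e (fun h₀ ↦ ?_) ⟨C / ‖u 0‖₊, ?_⟩
    · have := he 0
      simp [h₀] at this
    rintro _ ⟨k, rfl⟩
    refine ZeroAtInftyContinuousMap.nnnorm_le_of_apply_le fun n ↦ ?_
    have hk := key k e n
    rw [he] at hk
    by_cases hn : n + k = 0
    · rw [hn, Pi.single_eq_same, mul_one] at hk
      rw [le_div_iff₀ (nnnorm_pos.2 (hu₀ 0)), ← nnnorm_mul, hk]
      exact hC ⟨n, rfl⟩
    · rw [Pi.single_eq_of_ne hn, mul_zero, mul_eq_zero, or_iff_left (hu₀ _)] at hk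
      simp [hk]
  · rintro h x hx ⟨C, hC⟩
    obtain ⟨m, hm⟩ : ∃ m, x m ≠ 0 := by
      by_contra! h₀
      exact hx (ZeroAtInftyContinuousMap.ext h₀)
    refine h ⟨C * ‖u m‖₊ / ‖x m‖₊, ?_⟩
    rintro _ ⟨n, rfl⟩
    have hk := key (m - n) x n
    rw [add_sub_cancel] at hk
    rw [le_div_iff₀ (nnnorm_pos.2 hm), ← nnnorm_mul, ← hk, nnnorm_mul]
    gcongr
    exact (ZeroAtInftyContinuousMap.nnnorm_apply_le _ _).trans (hC ⟨m - n, rfl⟩)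

end Shift

/-- **Theorem.** The bilateral weighted backward shift `B_w` on `c₀(ℤ)` is expansive iff
`sup_n |w_{-n} ⋯ w_{-1}| = ∞` or `sup_n |w_1 ⋯ w_n|⁻¹ = ∞`. -/
theorem expansive_iff_bilateral_weighted_shift_c0
    {𝕜 : Type*} [RCLike 𝕜] (w : ℤ → 𝕜)
    (hw_bdd : ∃ C : ℝ, ∀ n : ℤ, ‖w n‖ ≤ C)
    (hw_below : ∃ c : ℝ, 0 < c ∧ ∀ n : ℤ, c ≤ ‖w n‖)
    -- `T` is the bilateral weighted backward shift `B_w` on `c₀(ℤ)`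
    (T : C₀(ℤ, 𝕜) ≃L[𝕜] C₀(ℤ, 𝕜))
    (hT : ∀ (x : C₀(ℤ, 𝕜)) (n : ℤ), T x n = w n * x (n + 1)) :
    -- `B_w` is expansive
    (∀ x : C₀(ℤ, 𝕜), x ≠ 0 → (⨆ n : ℤ, (‖(T ^ n) x‖₊ : ℝ≥0∞)) = ⊤)
    ↔ ((⨆ n : ℕ, (‖∏ j ∈ Finset.Icc 1 n, w (-(j : ℤ))‖₊ : ℝ≥0∞)) = ⊤ ∨
       (⨆ n : ℕ, (‖∏ j ∈ Finset.Icc 1 n, w (j : ℤ)‖₊ : ℝ≥0∞)⁻¹) = ⊤) := by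
  obtain ⟨c, hc, hcw⟩ := hw_below
  have hw (n : ℤ) : w n ≠ 0 := norm_pos_iff.1 (hc.trans_le (hcw n))
  obtain ⟨u, hu₀, hu, hneg, hpos⟩ := exists_weight_potential w hw
  have hinv (n : ℕ) : (‖∏ j ∈ Finset.Icc 1 n, w (j : ℤ)‖₊ : ℝ≥0∞)⁻¹ =
      ((‖w 0‖₊ * ‖u (n + 1)‖₊ : ℝ≥0) : ℝ≥0∞) := by
    rw [← nnnorm_mul, hpos, nnnorm_inv, ENNReal.coe_inv]
    exact nnnorm_ne_zero_iff.2 (Finset.prod_ne_zero_iff.2 fun _ _ ↦ hw _)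
  have hscale : BddAbove (Set.range fun n : ℕ ↦ ‖w 0‖₊ * ‖u (n + 1)‖₊) ↔
      BddAbove (Set.range fun n : ℕ ↦ ‖u (n + 1)‖₊) := by
    have h0 : 0 < ‖w 0‖₊ := nnnorm_pos.2 (hw 0)
    constructor
    · rintro ⟨C, hC⟩
      refine ⟨C / ‖w 0‖₊, ?_⟩
      rintro _ ⟨n, rfl⟩
      rw [le_div_iff₀' h0]
      exact hC ⟨n, rfl⟩
    · rintro ⟨C, hC⟩
      refine ⟨‖w 0‖₊ * C, ?_⟩
      rintro _ ⟨n, rfl⟩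
      exact mul_le_mul_right (hC ⟨n, rfl⟩) _
  simp_rw [hinv, ← hneg, ENNReal.iSup_coe_eq_top]
  rw [expansive_weightedShift_iff_not_bddAbove hw hu₀ hu hT, bddAbove_range_int_iff, hscale,
    not_and_or]
end

section
/- The bilateral weighted backward shift B_w on c₀(ℤ) is average expansive if and only if sup_{n∈ℕ} (1/n) Σ_{j=1}^{n} |w_{−j} ⋯ w_{−1}| = ∞ or sup_{n∈ℕ} (1/n) Σ_{j=1}^{n} 1/|w_1 ⋯ w_j| = ∞. -/
open Filter Topology
open scoped ENNReal NNReal ZeroAtInfty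

theorem Finset.sum_Icc_neg_natCast {M : Type*} [AddCommMonoid M] (f : ℤ → M) (n : ℕ) :
    ∑ j ∈ Finset.Icc (-(n : ℤ)) n, f j =
      f 0 + ∑ j ∈ Finset.Icc 1 n, f j + ∑ j ∈ Finset.Icc 1 n, f (-(j : ℤ)) := by
  induction n with
  | zero => simp
  | succ n ih =>
    have h : Finset.Icc (-((n + 1 : ℕ) : ℤ)) ((n + 1 : ℕ) : ℤ) =
        insert ((n + 1 : ℕ) : ℤ) (insert (-((n + 1 : ℕ) : ℤ)) (Finset.Icc (-(n : ℤ)) n)) := by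
      ext j
      simp only [Finset.mem_Icc, Finset.mem_insert]
      omega
    rw [h, Finset.sum_insert (by simp only [Finset.mem_insert, Finset.mem_Icc]; omega),
      Finset.sum_insert (by simp only [Finset.mem_Icc]; omega), ih,
      Finset.sum_Icc_succ_top (by omega), Finset.sum_Icc_succ_top (by omega)]
    abel

namespace ENNReal

theorem inv_natCast_le_three_mul {n : ℕ} (hn : 1 ≤ n) :
    (n : ℝ≥0∞)⁻¹ ≤ 3 * ((2 * n + 1 : ℕ) : ℝ≥0∞)⁻¹ := by
  rw [← div_eq_mul_inv, ENNReal.le_div_iff_mul_le (by simp) (by simp), mul_comm,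
    ← div_eq_mul_inv]
  refine ENNReal.div_le_of_le_mul ?_
  exact_mod_cast (by omega : 2 * n + 1 ≤ 3 * n)

/-- One-sided averages of `g` are controlled by symmetric averages of any `f` whose positive or
negative half dominates `g`. -/
theorem iSup_symm_average_eq_top {f : ℤ → ℝ≥0∞} {g : ℕ → ℝ≥0∞} {K : ℝ≥0∞} (hK : K ≠ ⊤)
    (hg : (∀ j : ℕ, g j ≤ K * f j) ∨ ∀ j : ℕ, g j ≤ K * f (-(j : ℤ)))
    (h : (⨆ n : ℕ, (n : ℝ≥0∞)⁻¹ * ∑ j ∈ Finset.Icc 1 n, g j) = ⊤) :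
    (⨆ n : ℕ, ((2 * n + 1 : ℕ) : ℝ≥0∞)⁻¹ * ∑ j ∈ Finset.Icc (-(n : ℤ)) n, f j) = ⊤ := by
  set S := ⨆ n : ℕ, ((2 * n + 1 : ℕ) : ℝ≥0∞)⁻¹ * ∑ j ∈ Finset.Icc (-(n : ℤ)) n, f j
  have hle : (⨆ n : ℕ, (n : ℝ≥0∞)⁻¹ * ∑ j ∈ Finset.Icc 1 n, g j) ≤ 3 * K * S := by
    refine iSup_le fun n => ?_
    rcases Nat.eq_zero_or_pos n with rfl | hn
    · simp
    have hsum : ∑ j ∈ Finset.Icc 1 n, g j ≤ K * ∑ j ∈ Finset.Icc (-(n : ℤ)) n, f j := by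
      rw [Finset.sum_Icc_neg_natCast]
      rcases hg with hg | hg
      · calc ∑ j ∈ Finset.Icc 1 n, g j ≤ K * ∑ j ∈ Finset.Icc 1 n, f j := by
              rw [Finset.mul_sum]
              exact Finset.sum_le_sum fun j _ => hg j
          _ ≤ _ := by
              gcongr
              exact le_add_self.trans le_self_add
      · calc ∑ j ∈ Finset.Icc 1 n, g j ≤ K * ∑ j ∈ Finset.Icc 1 n, f (-(j : ℤ)) := by
              rw [Finset.mul_sum]
              exact Finset.sum_le_sum fun j _ => hg j
          _ ≤ _ := by
              gcongr
              exact le_add_self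
    calc (n : ℝ≥0∞)⁻¹ * ∑ j ∈ Finset.Icc 1 n, g j
        ≤ (3 * ((2 * n + 1 : ℕ) : ℝ≥0∞)⁻¹) * (K * ∑ j ∈ Finset.Icc (-(n : ℤ)) n, f j) :=
          mul_le_mul' (inv_natCast_le_three_mul hn) hsum
      _ = 3 * K * (((2 * n + 1 : ℕ) : ℝ≥0∞)⁻¹ * ∑ j ∈ Finset.Icc (-(n : ℤ)) n, f j) := by ring
      _ ≤ 3 * K * S := by
          gcongr
          exact le_iSup (fun n : ℕ =>
            ((2 * n + 1 : ℕ) : ℝ≥0∞)⁻¹ * ∑ j ∈ Finset.Icc (-(n : ℤ)) n, f j) n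
  rw [h, top_le_iff] at hle
  by_contra hne
  exact ENNReal.mul_ne_top (ENNReal.mul_ne_top (by simp) hK) hne hle

/-- If the symmetric averages of `f` are unbounded, so are the averages of one of two functions
dominating its positive and negative halves. -/
theorem iSup_average_eq_top_or {f : ℤ → ℝ≥0∞} {g g' : ℕ → ℝ≥0∞} {K : ℝ≥0∞} (hK : K ≠ ⊤)
    (hf : f 0 ≠ ⊤) (hg : ∀ j : ℕ, f j ≤ K * g j) (hg' : ∀ j : ℕ, f (-(j : ℤ)) ≤ K * g' j)
    (h : (⨆ n : ℕ, ((2 * n + 1 : ℕ) : ℝ≥0∞)⁻¹ * ∑ j ∈ Finset.Icc (-(n : ℤ)) n, f j) = ⊤) :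
    (⨆ n : ℕ, (n : ℝ≥0∞)⁻¹ * ∑ j ∈ Finset.Icc 1 n, g j) = ⊤ ∨
      (⨆ n : ℕ, (n : ℝ≥0∞)⁻¹ * ∑ j ∈ Finset.Icc 1 n, g' j) = ⊤ := by
  by_contra! hne
  obtain ⟨h₁, h₂⟩ := hne
  have half : ∀ (a b : ℕ → ℝ≥0∞) (n : ℕ), (∀ j, a j ≤ K * b j) →
      ((2 * n + 1 : ℕ) : ℝ≥0∞)⁻¹ * ∑ j ∈ Finset.Icc 1 n, a j ≤
        K * ⨆ n : ℕ, (n : ℝ≥0∞)⁻¹ * ∑ j ∈ Finset.Icc 1 n, b j := by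
    intro a b n hab
    calc ((2 * n + 1 : ℕ) : ℝ≥0∞)⁻¹ * ∑ j ∈ Finset.Icc 1 n, a j
        ≤ (n : ℝ≥0∞)⁻¹ * (K * ∑ j ∈ Finset.Icc 1 n, b j) := by
          refine mul_le_mul' (ENNReal.inv_le_inv.2 ?_) ?_
          · exact_mod_cast (by omega : n ≤ 2 * n + 1)
          · rw [Finset.mul_sum]
            exact Finset.sum_le_sum fun j _ => hab j
      _ = K * ((n : ℝ≥0∞)⁻¹ * ∑ j ∈ Finset.Icc 1 n, b j) := by ring
      _ ≤ _ := by
          gcongr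
          exact le_iSup (fun n : ℕ => (n : ℝ≥0∞)⁻¹ * ∑ j ∈ Finset.Icc 1 n, b j) n
  refine ne_top_of_le_ne_top (ENNReal.add_ne_top.2 ⟨ENNReal.add_ne_top.2
    ⟨hf, ENNReal.mul_ne_top hK h₁⟩, ENNReal.mul_ne_top hK h₂⟩) (iSup_le fun n => ?_) h
  rw [Finset.sum_Icc_neg_natCast, mul_add, mul_add]
  refine add_le_add (add_le_add ?_ ?_) ?_
  · refine mul_le_of_le_one_left' (ENNReal.inv_le_one.2 ?_)
    exact_mod_cast (by omega : 1 ≤ 2 * n + 1)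
  · exact half _ _ n hg
  · exact half _ _ n hg'

end ENNReal

namespace ZeroAtInftyContinuousMap

theorem nnnorm_apply_le_s6 {α β : Type*} [TopologicalSpace α] [SeminormedAddCommGroup β]
    (x : C₀(α, β)) (a : α) : ‖x a‖₊ ≤ ‖x‖₊ :=
  x.toBCF.norm_coe_le_norm a

variable {𝕜 : Type*} [RCLike 𝕜]

/-- The canonical basis vector of `c₀(ℤ)`. -/
def basisVec (𝕜 : Type*) [RCLike 𝕜] (k : ℤ) : C₀(ℤ, 𝕜) where
  toFun := Pi.single k 1
  continuous_toFun := continuous_of_discreteTopology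
  zero_at_infty' := by
    rw [cocompact_eq_cofinite]
    refine tendsto_nhds_of_eventually_eq ?_
    filter_upwards [(Set.finite_singleton k).compl_mem_cofinite] with n hn
    exact Pi.single_eq_of_ne hn 1

theorem basisVec_apply (k n : ℤ) : basisVec 𝕜 k n = if n = k then 1 else 0 :=
  Pi.single_apply k 1 n

theorem basisVec_ne_zero (k : ℤ) : basisVec 𝕜 k ≠ 0 := fun h => by
  simpa [basisVec_apply] using DFunLike.congr_fun h k

theorem nnnorm_basisVec_le (k : ℤ) : ‖basisVec 𝕜 k‖₊ ≤ 1 := by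
  refine (BoundedContinuousFunction.norm_le (f := (basisVec 𝕜 k).toBCF) zero_le_one).2 fun n => ?_
  change ‖basisVec 𝕜 k n‖ ≤ 1
  rw [basisVec_apply]
  split_ifs <;> simp

end ZeroAtInftyContinuousMap

section WeightedShift

open ZeroAtInftyContinuousMap

variable {𝕜 : Type*} [RCLike 𝕜] {w : ℤ → 𝕜} {T : C₀(ℤ, 𝕜) ≃L[𝕜] C₀(ℤ, 𝕜)}

theorem weightedShift_inv_apply (hw : ∀ n, w n ≠ 0)
    (hT : ∀ (x : C₀(ℤ, 𝕜)) (n : ℤ), T x n = w n * x (n + 1)) (x : C₀(ℤ, 𝕜)) (n : ℤ) :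
    T⁻¹ x (n + 1) = (w n)⁻¹ * x n := by
  have h := hT (T⁻¹ x) n
  rw [show T (T⁻¹ x) = x from T.apply_symm_apply x] at h
  rw [h, inv_mul_cancel_left₀ (hw n)]

theorem weightedShift_zpow_apply_ne_zero (hw : ∀ n, w n ≠ 0)
    (hT : ∀ (x : C₀(ℤ, 𝕜)) (n : ℤ), T x n = w n * x (n + 1)) {x : C₀(ℤ, 𝕜)} {m : ℤ}
    (hx : x m ≠ 0) (k : ℤ) : (T ^ k) x (m - k) ≠ 0 := by
  induction k using Int.induction_on with
  | zero =>
    rw [sub_zero, zpow_zero]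
    exact hx
  | succ k ih =>
    rw [add_comm, zpow_one_add]
    change T ((T ^ (k : ℤ)) x) _ ≠ 0
    rw [hT, show m - (1 + (k : ℤ)) + 1 = m - k by ring]
    exact mul_ne_zero (hw _) ih
  | pred k ih =>
    rw [show -(k : ℤ) - 1 = -1 + -(k : ℤ) by ring, zpow_add, zpow_neg_one]
    change T⁻¹ ((T ^ (-(k : ℤ))) x) _ ≠ 0
    rw [show m - (-1 + -(k : ℤ)) = m - -(k : ℤ) + 1 by ring, weightedShift_inv_apply hw hT]
    exact mul_ne_zero (inv_ne_zero (hw _)) ih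

theorem weightedShift_pow_apply_neg
    (hT : ∀ (x : C₀(ℤ, 𝕜)) (n : ℤ), T x n = w n * x (n + 1)) (x : C₀(ℤ, 𝕜)) (j : ℕ) :
    (T ^ (j : ℤ)) x (-(j : ℤ)) = (∏ i ∈ Finset.Icc 1 j, w (-(i : ℤ))) * x 0 := by
  induction j with
  | zero =>
    simp only [Nat.cast_zero, neg_zero, zpow_zero, zero_lt_one, Finset.Icc_eq_empty_of_lt,
      Finset.prod_empty, one_mul]
    rfl
  | succ j ih =>
    rw [Finset.prod_Icc_succ_top (by omega), Nat.cast_succ, add_comm (j : ℤ), zpow_one_add]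
    change T ((T ^ (j : ℤ)) x) _ = _
    rw [hT, show -(1 + (j : ℤ)) + 1 = -j by ring, ih]
    ring

theorem weightedShift_inv_pow_apply (hw : ∀ n, w n ≠ 0)
    (hT : ∀ (x : C₀(ℤ, 𝕜)) (n : ℤ), T x n = w n * x (n + 1)) (x : C₀(ℤ, 𝕜)) (j : ℕ) :
    (T ^ (-(j : ℤ))) x ((j : ℤ) + 1) = (∏ i ∈ Finset.Icc 1 j, w (i : ℤ))⁻¹ * x 1 := by
  induction j with
  | zero =>
    simp only [Nat.cast_zero, neg_zero, zpow_zero, zero_lt_one, Finset.Icc_eq_empty_of_lt,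
      Finset.prod_empty, inv_one, one_mul, zero_add]
    rfl
  | succ j ih =>
    rw [Finset.prod_Icc_succ_top (by omega), Nat.cast_succ,
      show -((j : ℤ) + 1) = -1 + -j by ring, zpow_add, zpow_neg_one]
    change T⁻¹ ((T ^ (-(j : ℤ))) x) _ = _
    rw [weightedShift_inv_apply hw hT, ih, mul_inv]
    ring

theorem weightedShift_basisVec
    (hT : ∀ (x : C₀(ℤ, 𝕜)) (n : ℤ), T x n = w n * x (n + 1)) (k : ℤ) :
    T (basisVec 𝕜 (k + 1)) = w k • basisVec 𝕜 k := by
  ext n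
  rw [hT, ZeroAtInftyContinuousMap.smul_apply, basisVec_apply, basisVec_apply, smul_eq_mul]
  by_cases h : n = k <;> simp [h]

theorem weightedShift_inv_basisVec (hw : ∀ n, w n ≠ 0)
    (hT : ∀ (x : C₀(ℤ, 𝕜)) (n : ℤ), T x n = w n * x (n + 1)) (k : ℤ) :
    T⁻¹ (basisVec 𝕜 k) = (w k)⁻¹ • basisVec 𝕜 (k + 1) := by
  apply T.injective
  rw [map_smul, weightedShift_basisVec hT, inv_smul_smul₀ (hw k)]
  exact T.apply_symm_apply _

theorem weightedShift_pow_basisVec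
    (hT : ∀ (x : C₀(ℤ, 𝕜)) (n : ℤ), T x n = w n * x (n + 1)) (j : ℕ) :
    (T ^ (j : ℤ)) (basisVec 𝕜 0) =
      (∏ i ∈ Finset.Icc 1 j, w (-(i : ℤ))) • basisVec 𝕜 (-(j : ℤ)) := by
  induction j with
  | zero =>
    simp only [Nat.cast_zero, neg_zero, zpow_zero, zero_lt_one, Finset.Icc_eq_empty_of_lt,
      Finset.prod_empty, one_smul]
    rfl
  | succ j ih =>
    rw [Finset.prod_Icc_succ_top (by omega), Nat.cast_succ, add_comm (j : ℤ), zpow_one_add]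
    change T ((T ^ (j : ℤ)) _) = _
    rw [ih, map_smul, show -(j : ℤ) = -(1 + j) + 1 by ring, weightedShift_basisVec hT, smul_smul]

theorem weightedShift_inv_pow_basisVec (hw : ∀ n, w n ≠ 0)
    (hT : ∀ (x : C₀(ℤ, 𝕜)) (n : ℤ), T x n = w n * x (n + 1)) (j : ℕ) :
    (T ^ (-(j : ℤ))) (basisVec 𝕜 1) =
      (∏ i ∈ Finset.Icc 1 j, w (i : ℤ))⁻¹ • basisVec 𝕜 ((j : ℤ) + 1) := by
  induction j with
  | zero =>
    simp only [Nat.cast_zero, neg_zero, zpow_zero, zero_lt_one, Finset.Icc_eq_empty_of_lt,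
      Finset.prod_empty, inv_one, one_smul, zero_add]
    rfl
  | succ j ih =>
    rw [Finset.prod_Icc_succ_top (by omega), Nat.cast_succ,
      show -((j : ℤ) + 1) = -1 + -j by ring, zpow_add, zpow_neg_one]
    change T⁻¹ ((T ^ (-(j : ℤ))) _) = _
    rw [ih, map_smul, weightedShift_inv_basisVec hw hT, smul_smul, mul_inv]

theorem nnnorm_zpow_zpow_le (T : C₀(ℤ, 𝕜) ≃L[𝕜] C₀(ℤ, 𝕜)) (x : C₀(ℤ, 𝕜)) (j m : ℤ) :
    ‖(T ^ j) ((T ^ m) x)‖₊ ≤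
      ‖((T ^ m : C₀(ℤ, 𝕜) ≃L[𝕜] C₀(ℤ, 𝕜)) : C₀(ℤ, 𝕜) →L[𝕜] C₀(ℤ, 𝕜))‖₊ * ‖(T ^ j) x‖₊ := by
  have h : (T ^ j) ((T ^ m) x) = (T ^ m) ((T ^ j) x) :=
    DFunLike.congr_fun (zpow_mul_comm T j m) x
  rw [h]
  exact ContinuousLinearMap.le_opNNNorm
    ((T ^ m : C₀(ℤ, 𝕜) ≃L[𝕜] C₀(ℤ, 𝕜)) : C₀(ℤ, 𝕜) →L[𝕜] C₀(ℤ, 𝕜)) ((T ^ j) x)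

/-- A coordinate of `T ^ j` applied to a translate `T ^ m x` bounds the orbit of `x` from below. -/
theorem ennreal_le_mul_nnnorm_zpow {x : C₀(ℤ, 𝕜)} {a b : 𝕜} {j m n : ℤ} (hb : b ≠ 0)
    (h : (T ^ j) ((T ^ m) x) n = a * b) :
    (‖a‖₊ : ℝ≥0∞) ≤ ((‖b‖₊⁻¹ *
      ‖((T ^ m : C₀(ℤ, 𝕜) ≃L[𝕜] C₀(ℤ, 𝕜)) : C₀(ℤ, 𝕜) →L[𝕜] C₀(ℤ, 𝕜))‖₊ : ℝ≥0) : ℝ≥0∞) *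
        (‖(T ^ j) x‖₊ : ℝ≥0∞) := by
  rw [← ENNReal.coe_mul, ENNReal.coe_le_coe, mul_assoc,
    le_inv_mul_iff₀ (nnnorm_pos.2 hb), mul_comm, ← nnnorm_mul, ← h]
  exact (nnnorm_apply_le_s6 _ n).trans (nnnorm_zpow_zpow_le T x j m)

end WeightedShift

/-- **Theorem.** The bilateral weighted backward shift `B_w` on `c₀(ℤ)` is average expansive iff
`sup_n (1/n) Σ_{j=1}^n |w_{-j} ⋯ w_{-1}| = ∞` or `sup_n (1/n) Σ_{j=1}^n 1/|w_1 ⋯ w_j| = ∞`. -/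
theorem averageExpansive_iff_bilateral_weighted_shift_c0
    {𝕜 : Type*} [RCLike 𝕜] (w : ℤ → 𝕜)
    (hw_bdd : ∃ C : ℝ, ∀ n : ℤ, ‖w n‖ ≤ C)
    (hw_below : ∃ c : ℝ, 0 < c ∧ ∀ n : ℤ, c ≤ ‖w n‖)
    -- `T` is the bilateral weighted backward shift `B_w` on `c₀(ℤ)`
    (T : C₀(ℤ, 𝕜) ≃L[𝕜] C₀(ℤ, 𝕜))
    (hT : ∀ (x : C₀(ℤ, 𝕜)) (n : ℤ), T x n = w n * x (n + 1)) :
    -- `B_w` is average expansive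
    (∀ x : C₀(ℤ, 𝕜), x ≠ 0 →
      (⨆ n : ℕ, (((2 * n + 1 : ℕ) : ℝ≥0∞))⁻¹ *
        ∑ j ∈ Finset.Icc (-(n : ℤ)) (n : ℤ), (‖(T ^ j) x‖₊ : ℝ≥0∞)) = ⊤)
    ↔ ((⨆ n : ℕ, ((n : ℝ≥0∞))⁻¹ *
          ∑ j ∈ Finset.Icc 1 n, (‖∏ i ∈ Finset.Icc 1 j, w (-(i : ℤ))‖₊ : ℝ≥0∞)) = ⊤ ∨
       (⨆ n : ℕ, ((n : ℝ≥0∞))⁻¹ *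
          ∑ j ∈ Finset.Icc 1 n, (‖∏ i ∈ Finset.Icc 1 j, w (i : ℤ)‖₊ : ℝ≥0∞)⁻¹) = ⊤) := by
  obtain ⟨c, hc, hcw⟩ := hw_below
  have hw : ∀ n, w n ≠ 0 := fun n => norm_pos_iff.1 (hc.trans_le (hcw n))
  have inv_coe : ∀ j : ℕ, (‖∏ i ∈ Finset.Icc 1 j, w (i : ℤ)‖₊ : ℝ≥0∞)⁻¹ =
      (‖(∏ i ∈ Finset.Icc 1 j, w (i : ℤ))⁻¹‖₊ : ℝ≥0∞) := fun j => by
    rw [nnnorm_inv, ENNReal.coe_inv]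
    exact nnnorm_ne_zero_iff.2 (Finset.prod_ne_zero_iff.2 fun i _ => hw i)
  simp_rw [inv_coe]
  constructor
  · intro h
    have hle (a : 𝕜) (k : ℤ) : ‖a • ZeroAtInftyContinuousMap.basisVec 𝕜 k‖₊ ≤ ‖a‖₊ := by
      rw [nnnorm_smul]
      exact mul_le_of_le_one_right' (ZeroAtInftyContinuousMap.nnnorm_basisVec_le k)
    set L := ‖((T ^ (1 : ℤ) : C₀(ℤ, 𝕜) ≃L[𝕜] C₀(ℤ, 𝕜)) : C₀(ℤ, 𝕜) →L[𝕜] C₀(ℤ, 𝕜))‖₊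
    refine ENNReal.iSup_average_eq_top_or (K := ((1 + ‖w 0‖₊⁻¹ * L : ℝ≥0) : ℝ≥0∞))
      ENNReal.coe_ne_top ENNReal.coe_ne_top (fun j => ?_) (fun j => ?_)
      (h (ZeroAtInftyContinuousMap.basisVec 𝕜 0) (ZeroAtInftyContinuousMap.basisVec_ne_zero 0))
    · rw [← ENNReal.coe_mul, ENNReal.coe_le_coe, weightedShift_pow_basisVec hT]
      exact (hle _ _).trans (le_mul_of_one_le_left' le_self_add)
    · rw [← ENNReal.coe_mul, ENNReal.coe_le_coe]
      have h₀ : (T ^ (1 : ℤ)) (ZeroAtInftyContinuousMap.basisVec 𝕜 1) =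
          w 0 • ZeroAtInftyContinuousMap.basisVec 𝕜 0 := by
        rw [zpow_one]
        exact weightedShift_basisVec hT 0
      have h₁ := nnnorm_zpow_zpow_le T (ZeroAtInftyContinuousMap.basisVec 𝕜 1) (-(j : ℤ)) 1
      rw [h₀, map_smul, nnnorm_smul, weightedShift_inv_pow_basisVec hw hT] at h₁
      rw [add_mul, mul_assoc]
      refine le_add_of_nonneg_of_le zero_le ?_
      rw [le_inv_mul_iff₀ (nnnorm_pos.2 (hw 0))]
      exact h₁.trans (mul_le_mul_right (hle _ _) _)
  · intro h x hx
    obtain ⟨m, hm⟩ : ∃ m, x m ≠ 0 := by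
      by_contra! h0
      exact hx (ZeroAtInftyContinuousMap.ext h0)
    rcases h with h | h
    · have hb := weightedShift_zpow_apply_ne_zero hw hT hm m
      rw [sub_self] at hb
      exact ENNReal.iSup_symm_average_eq_top ENNReal.coe_ne_top (Or.inl fun j =>
        ennreal_le_mul_nnnorm_zpow hb (weightedShift_pow_apply_neg hT _ j)) h
    · have hb := weightedShift_zpow_apply_ne_zero hw hT hm (m - 1)
      rw [sub_sub_cancel] at hb
      exact ENNReal.iSup_symm_average_eq_top ENNReal.coe_ne_top (Or.inr fun j =>
        ennreal_le_mul_nnnorm_zpow hb (weightedShift_inv_pow_apply hw hT _ j)) h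
end

section
/- The bilateral weighted backward shift B_w on c₀(ℤ) is uniformly expansive if and only if there exists a partition (I,J) of ℤ such that lim_{n→∞} inf_{k∈I} |w_{k−n+1} ⋯ w_k| = ∞ and lim_{n→∞} inf_{k∈J} |w_{k+1} ⋯ w_{k+n}|^{−1} = ∞, where the infimum over the empty set is defined to be ∞. -/
open Filter Topology
open scoped ENNReal NNReal ZeroAtInfty

namespace ZeroAtInftyContinuousMap

theorem norm_apply_le {α β : Type*} [TopologicalSpace α] [SeminormedAddCommGroup β]
    (x : C₀(α, β)) (a : α) : ‖x a‖ ≤ ‖x‖ := by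
  rw [← norm_toBCF_eq_norm]
  exact x.toBCF.norm_coe_le_norm a

theorem norm_le_of_forall_apply_le {α β : Type*} [TopologicalSpace α] [SeminormedAddCommGroup β]
    {x : C₀(α, β)} {C : ℝ} (hC : 0 ≤ C) (h : ∀ a, ‖x a‖ ≤ C) : ‖x‖ ≤ C := by
  rw [← norm_toBCF_eq_norm]
  exact (BoundedContinuousFunction.norm_le hC).2 h

/-- A nonzero function vanishing at infinity attains its norm. -/
theorem exists_norm_apply_eq_norm {α β : Type*} [TopologicalSpace α] [NormedAddCommGroup β]
    {x : C₀(α, β)} (hx : x ≠ 0) : ∃ a, ‖x a‖ = ‖x‖ := by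
  obtain ⟨a₀, ha₀⟩ := DFunLike.ne_iff.1 hx
  have hpos : 0 < ‖x a₀‖ := norm_pos_iff.2 ha₀
  have hev : ∀ᶠ a in cocompact α, ‖x a‖ ≤ ‖x a₀‖ := by
    have h0 := (zero_at_infty x).norm
    rw [norm_zero] at h0
    exact (h0.eventually_lt_const hpos).mono fun _ h => h.le
  obtain ⟨a, ha⟩ := (map_continuous x).norm.exists_forall_ge' a₀ hev
  exact ⟨a, le_antisymm (norm_apply_le x a) (norm_le_of_forall_apply_le (norm_nonneg _) ha)⟩

/-- The canonical unit vector of `C₀(α, 𝕜)` supported at a point of a discrete space. -/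
def single {α : Type*} [TopologicalSpace α] [DiscreteTopology α] [DecidableEq α]
    (𝕜 : Type*) [RCLike 𝕜] (a : α) : C₀(α, 𝕜) where
  toFun := Pi.single a 1
  continuous_toFun := continuous_of_discreteTopology
  zero_at_infty' := by
    rw [cocompact_eq_cofinite]
    refine tendsto_const_nhds.congr' ?_
    filter_upwards [(Set.finite_singleton a).compl_mem_cofinite] with b hb
    exact (Pi.single_eq_of_ne (M := fun _ => 𝕜) hb 1).symm

theorem single_self {α : Type*} [TopologicalSpace α] [DiscreteTopology α] [DecidableEq α]
    (𝕜 : Type*) [RCLike 𝕜] (a : α) : single 𝕜 a a = 1 :=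
  Pi.single_eq_same a 1

theorem single_of_ne {α : Type*} [TopologicalSpace α] [DiscreteTopology α] [DecidableEq α]
    (𝕜 : Type*) [RCLike 𝕜] {a b : α} (h : b ≠ a) : single 𝕜 a b = 0 :=
  Pi.single_eq_of_ne h 1

theorem norm_single {α : Type*} [TopologicalSpace α] [DiscreteTopology α] [DecidableEq α]
    (𝕜 : Type*) [RCLike 𝕜] (a : α) : ‖single 𝕜 a‖ = 1 := by
  refine le_antisymm (norm_le_of_forall_apply_le zero_le_one fun b => ?_) ?_
  · rcases eq_or_ne b a with rfl | h
    · simp [single_self]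
    · simp [single_of_ne 𝕜 h]
  · simpa [single_self] using norm_apply_le (single 𝕜 a) a

end ZeroAtInftyContinuousMap

namespace BilateralWeightedShift

open ZeroAtInftyContinuousMap

variable {𝕜 : Type*} [RCLike 𝕜] {w : ℤ → 𝕜} {T : C₀(ℤ, 𝕜) ≃L[𝕜] C₀(ℤ, 𝕜)}

theorem zpow_natCast_apply (hT : ∀ (x : C₀(ℤ, 𝕜)) (n : ℤ), T x n = w n * x (n + 1))
    (n : ℕ) (x : C₀(ℤ, 𝕜)) (k : ℤ) :
    (T ^ (n : ℤ)) x (k + 1 - n) = (∏ j ∈ Finset.range n, w (k - (j : ℤ))) * x (k + 1) := by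
  rw [zpow_natCast]
  induction n with
  | zero =>
    have h : (1 : C₀(ℤ, 𝕜) ≃L[𝕜] C₀(ℤ, 𝕜)) x = x := rfl
    simp [h]
  | succ n ih =>
    have h : (T ^ (n + 1)) x = T ((T ^ n) x) := by rw [pow_succ']; rfl
    rw [h, hT, Finset.prod_range_succ,
      show k + 1 - ((n + 1 : ℕ) : ℤ) = k - n by push_cast; ring,
      show k - n + 1 = k + 1 - (n : ℤ) by ring, ih]
    ring

theorem zpow_natCast_apply_add_one (hT : ∀ (x : C₀(ℤ, 𝕜)) (n : ℤ), T x n = w n * x (n + 1))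
    (n : ℕ) (x : C₀(ℤ, 𝕜)) (k : ℤ) :
    (T ^ (n : ℤ)) x (k + 1) = (∏ j ∈ Finset.Icc 1 n, w (k + (j : ℤ))) * x (k + 1 + n) := by
  rw [zpow_natCast]
  induction n generalizing x with
  | zero =>
    have h : (1 : C₀(ℤ, 𝕜) ≃L[𝕜] C₀(ℤ, 𝕜)) x = x := rfl
    simp [h]
  | succ n ih =>
    have h : (T ^ (n + 1)) x = (T ^ n) (T x) := by rw [pow_succ]; rfl
    rw [h, ih, hT, Finset.prod_Icc_succ_top (by omega),
      show k + 1 + (n : ℤ) + 1 = k + 1 + ((n + 1 : ℕ) : ℤ) by push_cast; ring,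
      show k + ((n + 1 : ℕ) : ℤ) = k + 1 + n by push_cast; ring]
    ring

theorem zpow_neg_natCast_apply (hT : ∀ (x : C₀(ℤ, 𝕜)) (n : ℤ), T x n = w n * x (n + 1))
    (hw : ∀ n, w n ≠ 0) (n : ℕ) (x : C₀(ℤ, 𝕜)) (k : ℤ) :
    (T ^ (-(n : ℤ))) x (k + 1 + n) =
      (∏ j ∈ Finset.Icc 1 n, w (k + (j : ℤ)))⁻¹ * x (k + 1) := by
  have h := zpow_natCast_apply_add_one hT n ((T ^ (-(n : ℤ))) x) k
  have hx : (T ^ (n : ℤ)) ((T ^ (-(n : ℤ))) x) = x := by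
    rw [zpow_neg]
    exact (T ^ (n : ℤ)).apply_symm_apply x
  rw [hx] at h
  rw [h, inv_mul_cancel_left₀ (Finset.prod_ne_zero_iff.2 fun _ _ => hw _)]

theorem norm_zpow_natCast_single_le
    (hT : ∀ (x : C₀(ℤ, 𝕜)) (n : ℤ), T x n = w n * x (n + 1)) (n : ℕ) (k : ℤ) :
    ‖(T ^ (n : ℤ)) (single 𝕜 (k + 1))‖ ≤ ‖∏ j ∈ Finset.range n, w (k - (j : ℤ))‖ := by
  refine norm_le_of_forall_apply_le (norm_nonneg _) fun m => ?_
  obtain ⟨l, rfl⟩ : ∃ l : ℤ, m = l + 1 - n := ⟨m + n - 1, by ring⟩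
  rw [zpow_natCast_apply hT]
  rcases eq_or_ne l k with rfl | h
  · simp [single_self]
  · rw [single_of_ne 𝕜 (by simpa using h), mul_zero, norm_zero]
    exact norm_nonneg _

theorem norm_zpow_neg_natCast_single_le
    (hT : ∀ (x : C₀(ℤ, 𝕜)) (n : ℤ), T x n = w n * x (n + 1)) (hw : ∀ n, w n ≠ 0)
    (n : ℕ) (k : ℤ) :
    ‖(T ^ (-(n : ℤ))) (single 𝕜 (k + 1))‖ ≤ ‖(∏ j ∈ Finset.Icc 1 n, w (k + (j : ℤ)))⁻¹‖ := by
  refine norm_le_of_forall_apply_le (norm_nonneg _) fun m => ?_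
  obtain ⟨l, rfl⟩ : ∃ l : ℤ, m = l + 1 + n := ⟨m - n - 1, by ring⟩
  rw [zpow_neg_natCast_apply hT hw]
  rcases eq_or_ne l k with rfl | h
  · simp [single_self]
  · rw [single_of_ne 𝕜 (by simpa using h), mul_zero, norm_zero]
    exact norm_nonneg _

theorem coe_nnnorm_prod_inv (hw : ∀ n, w n ≠ 0) (n : ℕ) (k : ℤ) :
    (‖∏ j ∈ Finset.Icc 1 n, w (k + (j : ℤ))‖₊ : ℝ≥0∞)⁻¹ =
      (‖(∏ j ∈ Finset.Icc 1 n, w (k + (j : ℤ)))⁻¹‖₊ : ℝ≥0∞) := by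
  rw [nnnorm_inv, ENNReal.coe_inv]
  exact nnnorm_ne_zero_iff.2 (Finset.prod_ne_zero_iff.2 fun _ _ => hw _)

end BilateralWeightedShift

open ZeroAtInftyContinuousMap BilateralWeightedShift

/-- **Theorem.** The bilateral weighted backward shift `B_w` on `c₀(ℤ)` is uniformly expansive
iff there is a partition `(I, J)` of `ℤ` such that
`lim_n inf_{k ∈ I} |w_{k-n+1} ⋯ w_k| = ∞` and `lim_n inf_{k ∈ J} |w_{k+1} ⋯ w_{k+n}|⁻¹ = ∞`
(with the infimum over the empty set being `∞`). -/
theorem uniformlyExpansive_iff_bilateral_weighted_shift_c0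
    {𝕜 : Type*} [RCLike 𝕜] (w : ℤ → 𝕜)
    (hw_bdd : ∃ C : ℝ, ∀ n : ℤ, ‖w n‖ ≤ C)
    (hw_below : ∃ c : ℝ, 0 < c ∧ ∀ n : ℤ, c ≤ ‖w n‖)
    -- `T` is the bilateral weighted backward shift `B_w` on `c₀(ℤ)`
    (T : C₀(ℤ, 𝕜) ≃L[𝕜] C₀(ℤ, 𝕜))
    (hT : ∀ (x : C₀(ℤ, 𝕜)) (n : ℤ), T x n = w n * x (n + 1)) :
    -- `B_w` is uniformly expansive
    (∃ Sp Sm : Set C₀(ℤ, 𝕜),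
        Sp ⊆ {x : C₀(ℤ, 𝕜) | ‖x‖ = 1} ∧ Sm ⊆ {x : C₀(ℤ, 𝕜) | ‖x‖ = 1} ∧
        {x : C₀(ℤ, 𝕜) | ‖x‖ = 1} = Sp ∪ Sm ∧
        Tendsto (fun n : ℕ => ⨅ x ∈ Sp, (‖(T ^ (n : ℤ)) x‖₊ : ℝ≥0∞)) atTop (𝓝 ⊤) ∧
        Tendsto (fun n : ℕ => ⨅ x ∈ Sm, (‖(T ^ (-(n : ℤ))) x‖₊ : ℝ≥0∞)) atTop (𝓝 ⊤))
    ↔ (∃ I J : Set ℤ, I ∪ J = Set.univ ∧ I ∩ J = ∅ ∧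
        Tendsto (fun n : ℕ =>
          ⨅ k ∈ I, (‖∏ j ∈ Finset.range n, w (k - (j : ℤ))‖₊ : ℝ≥0∞)) atTop (𝓝 ⊤) ∧
        Tendsto (fun n : ℕ =>
          ⨅ k ∈ J, (‖∏ j ∈ Finset.Icc 1 n, w (k + (j : ℤ))‖₊ : ℝ≥0∞)⁻¹) atTop (𝓝 ⊤)) := by
  have hw : ∀ n, w n ≠ 0 := by
    obtain ⟨c, hc, h⟩ := hw_below
    exact fun n => norm_pos_iff.1 (hc.trans_le (h n))
  simp only [coe_nnnorm_prod_inv hw]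
  constructor
  · rintro ⟨Sp, Sm, -, -, hS, hp, hm⟩
    refine ⟨{k | single 𝕜 (k + 1) ∈ Sp}, {k | single 𝕜 (k + 1) ∈ Sp}ᶜ, Set.union_compl_self _,
      Set.inter_compl_self _, tendsto_nhds_top_mono' hp fun n => ?_,
      tendsto_nhds_top_mono' hm fun n => ?_⟩
    · refine le_iInf₂ fun k hk => (iInf₂_le (single 𝕜 (k + 1)) hk).trans ?_
      exact ENNReal.coe_le_coe.2 (norm_zpow_natCast_single_le hT n k)
    · refine le_iInf₂ fun k hk => (iInf₂_le (single 𝕜 (k + 1)) ?_).trans ?_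
      · have h : single 𝕜 (k + 1) ∈ Sp ∪ Sm := hS ▸ norm_single 𝕜 (k + 1)
        exact h.resolve_left hk
      · exact ENNReal.coe_le_coe.2 (norm_zpow_neg_natCast_single_le hT hw n k)
  · rintro ⟨I, J, hIJ, -, hI, hJ⟩
    refine ⟨{x | ‖x‖ = 1 ∧ ∃ k ∈ I, ‖x (k + 1)‖ = 1}, {x | ‖x‖ = 1 ∧ ∃ k ∈ J, ‖x (k + 1)‖ = 1},
      fun x hx => hx.1, fun x hx => hx.1, Set.Subset.antisymm (fun x hx => ?_)
      (Set.union_subset (fun x hx => hx.1) fun x hx => hx.1),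
      tendsto_nhds_top_mono' hI fun n => ?_, tendsto_nhds_top_mono' hJ fun n => ?_⟩
    · have hx1 : ‖x‖ = 1 := hx
      obtain ⟨m, hm⟩ := exists_norm_apply_eq_norm (norm_ne_zero_iff.1 (hx1 ▸ one_ne_zero))
      have hm1 : ‖x (m - 1 + 1)‖ = 1 := by rw [sub_add_cancel, hm, hx1]
      have hmem : m - 1 ∈ I ∪ J := hIJ ▸ Set.mem_univ _
      exact hmem.imp (fun h => ⟨hx1, _, h, hm1⟩) fun h => ⟨hx1, _, h, hm1⟩
    · refine le_iInf₂ fun x ⟨_, k, hk, hxk⟩ => (iInf₂_le k hk).trans (ENNReal.coe_le_coe.2 ?_)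
      have h := norm_apply_le ((T ^ (n : ℤ)) x) (k + 1 - n)
      rwa [zpow_natCast_apply hT, norm_mul, hxk, mul_one] at h
    · refine le_iInf₂ fun x ⟨_, k, hk, hxk⟩ => (iInf₂_le k hk).trans (ENNReal.coe_le_coe.2 ?_)
      have h := norm_apply_le ((T ^ (-(n : ℤ))) x) (k + 1 + n)
      rwa [zpow_neg_natCast_apply hT hw, norm_mul, hxk, mul_one] at h
end

section
/- Let (X,𝔐,μ,f,w) be a dissipative invertible weighted p-measurable system with wandering set W satisfying 0 < μ(W) < ∞, and let ν be the measure on (X,𝔐) defined by ν(B) = Σ_{n∈ℤ} μ_n(B ∩ f^{−n}(W)). Then the map Π : L^p(μ) → L^p(ν) given by Π(φ) = Σ_{n∈ℤ} (φ/w^(n))·χ_{f^{−n}(W)} is a surjective linear isometry, and Π ∘ C_{w,f} = C_f ∘ Π, where C_f(ψ) = ψ∘f is the (unweighted) composition operator on L^p(ν). In particular, C_{w,f} on L^p(μ) is conjugate to C_f on L^p(ν). -/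
open Filter Topology MeasureTheory
open scoped ENNReal NNReal

/-- The bilateral sequence of weight functions `w^(n)` associated to a bijection `f` and a
weight `w`:  `w^(0) = 1`, `w^(n) = (w∘f^(n-1))⋯(w∘f)·w` for `n ≥ 1`, and
`w^(-n) = (w̃∘f^(-(n-1)))⋯(w̃∘f⁻¹)·w̃` where `w̃ = 1/(w∘f⁻¹)`. -/
noncomputable def wpow {𝕜 X : Type*} [RCLike 𝕜] (f : Equiv.Perm X) (w : X → 𝕜) (n : ℤ)
    (x : X) : 𝕜 :=
  if 0 ≤ n then ∏ j ∈ Finset.range n.toNat, w ((f ^ (j : ℤ)) x)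
  else (∏ j ∈ Finset.range (-n).toNat, w ((f ^ (n + (j : ℤ))) x))⁻¹

/-- The measure `ν(B) = Σ_{n ∈ ℤ} μ_n(B ∩ f⁻ⁿ(W))`, where `μ_n(B) = ∫_B |w^(n)|^p dμ`. -/
noncomputable def nuMeas {𝕜 X : Type*} [RCLike 𝕜] [MeasurableSpace X] (μ : Measure X)
    (p : ℝ≥0∞) (f : Equiv.Perm X) (w : X → 𝕜) (W : Set X) : Measure X :=
  Measure.sum fun n : ℤ =>
    (μ.withDensity fun x => (‖wpow f w n x‖₊ : ℝ≥0∞) ^ p.toReal).restrict (⇑(f ^ n) ⁻¹' W)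

theorem wpow_ne_zero {𝕜 X : Type*} [RCLike 𝕜] (f : Equiv.Perm X) {w : X → 𝕜}
    (hw0 : ∀ x, w x ≠ 0) (n : ℤ) (x : X) : wpow f w n x ≠ 0 := by
  unfold wpow
  split_ifs
  · exact Finset.prod_ne_zero_iff.2 fun _ _ => hw0 _
  · exact inv_ne_zero (Finset.prod_ne_zero_iff.2 fun _ _ => hw0 _)

theorem wpow_eq_mul_wpow_sub_one {𝕜 X : Type*} [RCLike 𝕜] (f : Equiv.Perm X) {w : X → 𝕜}
    (hw0 : ∀ x, w x ≠ 0) (n : ℤ) (x : X) :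
    wpow f w n x = w x * wpow f w (n - 1) (f x) := by
  have shift (k : ℤ) : (f ^ k) (f x) = (f ^ (k + 1)) x := by
    rw [zpow_add_one, Equiv.Perm.mul_apply]
  unfold wpow
  rcases lt_or_ge 0 n with hn | hn
  · obtain ⟨m, rfl⟩ : ∃ m : ℕ, n = m + 1 := ⟨(n - 1).toNat, by omega⟩
    rw [if_pos (by omega), if_pos (by omega), show ((m : ℤ) + 1).toNat = m + 1 by omega,
      show ((m : ℤ) + 1 - 1).toNat = m by omega, Finset.prod_range_succ', mul_comm]
    simp only [shift, Nat.cast_add, Nat.cast_one, Nat.cast_zero, zpow_zero,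
      Equiv.Perm.one_apply]
  · obtain ⟨m, rfl⟩ : ∃ m : ℕ, n = -(m : ℤ) := ⟨(-n).toNat, by omega⟩
    have hneg : wpow f w (-(m : ℤ)) x
        = (∏ j ∈ Finset.range m, w ((f ^ (-(m : ℤ) + (j : ℤ))) x))⁻¹ := by
      rcases m with _ | m
      · simp [wpow]
      · rw [wpow, if_neg (by omega)]
        simp
    change wpow f w (-(m : ℤ)) x = _
    rw [hneg, if_neg (by omega), show (-(-(m : ℤ) - 1)).toNat = m + 1 by omega,
      Finset.prod_range_succ]
    have e (j : ℕ) : -(m : ℤ) - 1 + j + 1 = -m + j := by ring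
    simp only [shift, e, neg_add_cancel, zpow_zero, Equiv.Perm.one_apply, mul_inv]
    field_simp [hw0 x]

theorem Equiv.Perm.measurable_zpow {X : Type*} [MeasurableSpace X] {f : Equiv.Perm X}
    (hf : Measurable f) (hf' : Measurable f.symm) (n : ℤ) : Measurable ⇑(f ^ n) := by
  have hpow {g : Equiv.Perm X} (hg : Measurable g) (k : ℕ) : Measurable ⇑(g ^ k) := by
    rw [Equiv.Perm.coe_pow]
    exact hg.iterate k
  rcases n with k | k
  · simpa using hpow hf k
  · rw [zpow_negSucc, ← inv_pow]
    exact hpow hf' _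

theorem measurable_wpow {𝕜 X : Type*} [RCLike 𝕜] [MeasurableSpace X] {f : Equiv.Perm X}
    (hf : Measurable f) (hf' : Measurable f.symm) {w : X → 𝕜} (hw : Measurable w) (n : ℤ) :
    Measurable (wpow f w n) := by
  have hcomp (k : ℤ) : Measurable fun x => w ((f ^ k) x) :=
    hw.comp (Equiv.Perm.measurable_zpow hf hf' k)
  unfold wpow
  split_ifs
  · exact Finset.measurable_fun_prod _ fun _ _ => hcomp _
  · exact (Finset.measurable_fun_prod _ fun _ _ => hcomp _).inv

/-- Dividing by `u` does not change the `L^p` seminorm when the measure is given the density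
`‖u‖^p`. -/
theorem eLpNorm_div_withDensity {𝕜 X : Type*} [RCLike 𝕜] [MeasurableSpace X] {μ : Measure X}
    {p : ℝ≥0∞} (hp0 : p ≠ 0) (hp : p ≠ ⊤) {u : X → 𝕜} (hu : Measurable u)
    (hu0 : ∀ x, u x ≠ 0) (φ : X → 𝕜) :
    eLpNorm (fun x => φ x / u x) p (μ.withDensity fun x => ‖u x‖ₑ ^ p.toReal)
      = eLpNorm φ p μ := by
  have hmeas : Measurable fun x => ‖u x‖ₑ ^ p.toReal := hu.enorm.pow_const _
  rw [eLpNorm_eq_lintegral_rpow_enorm_toReal hp0 hp, eLpNorm_eq_lintegral_rpow_enorm_toReal hp0 hp,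
    lintegral_withDensity_eq_lintegral_mul_non_measurable _ hmeas
      (Eventually.of_forall fun x =>
        ENNReal.rpow_lt_top_of_nonneg ENNReal.toReal_nonneg enorm_ne_top)]
  congr 2
  funext x
  rw [Pi.mul_apply, ← ENNReal.mul_rpow_of_nonneg _ _ ENNReal.toReal_nonneg, ← enorm_mul,
    mul_div_cancel₀ _ (hu0 x)]

/-- Division by a nowhere vanishing function `u` is an isometric isomorphism from `L^p(μ)` onto
`L^p(‖u‖^p μ)`. -/
theorem exists_linearIsometryEquiv_Lp_withDensity {𝕜 X : Type*} [RCLike 𝕜] [MeasurableSpace X]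
    (μ : Measure X) (p : ℝ≥0∞) [Fact (1 ≤ p)] (hp : p ≠ ⊤) {u : X → 𝕜} (hu : Measurable u)
    (hu0 : ∀ x, u x ≠ 0) :
    ∃ E : Lp 𝕜 p μ ≃ₗᵢ[𝕜] Lp 𝕜 p (μ.withDensity fun x => ‖u x‖ₑ ^ p.toReal),
      ∀ φ : Lp 𝕜 p μ, ⇑(E φ) =ᵐ[μ.withDensity fun x => ‖u x‖ₑ ^ p.toReal]
        fun x => φ x / u x := by
  have hp0 : p ≠ 0 := (zero_lt_one.trans_le Fact.out).ne'
  set ν := μ.withDensity fun x => ‖u x‖ₑ ^ p.toReal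
  have hac : ν ≪ μ := withDensity_absolutelyContinuous _ _
  have hac' : μ ≪ ν := withDensity_absolutelyContinuous' (hu.enorm.pow_const _).aemeasurable
    (Eventually.of_forall fun x => by simp [hu0 x])
  have hmem (φ : Lp 𝕜 p μ) : MemLp (fun x => φ x / u x) p ν := by
    refine ⟨((Lp.aestronglyMeasurable φ).div₀ hu.aestronglyMeasurable).mono_ac hac, ?_⟩
    rw [eLpNorm_div_withDensity hp0 hp hu hu0]
    exact Lp.eLpNorm_lt_top φ
  let L : Lp 𝕜 p μ →ₗᵢ[𝕜] Lp 𝕜 p ν :=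
    { toFun := fun φ => (hmem φ).toLp
      map_add' := fun φ ψ => by
        rw [← MemLp.toLp_add]
        refine MemLp.toLp_congr _ _ ?_
        filter_upwards [hac.ae_le (Lp.coeFn_add φ ψ)] with x hx
        exact (congrArg (· / u x) hx).trans (add_div _ _ _)
      map_smul' := fun c φ => by
        rw [RingHom.id_apply, ← MemLp.toLp_const_smul]
        refine MemLp.toLp_congr _ _ ?_
        filter_upwards [hac.ae_le (Lp.coeFn_smul c φ)] with x hx
        exact (congrArg (· / u x) hx).trans (mul_div_assoc _ _ _)
      norm_map' := fun φ => by
        change ‖(hmem φ).toLp‖ = ‖φ‖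
        rw [Lp.norm_toLp, eLpNorm_div_withDensity hp0 hp hu hu0, Lp.norm_def] }
  have hsurj : Function.Surjective L := by
    intro ψ
    have hφ : MemLp (fun x => ψ x * u x) p μ := by
      refine ⟨((Lp.aestronglyMeasurable ψ).mono_ac hac').mul hu.aestronglyMeasurable, ?_⟩
      rw [← eLpNorm_div_withDensity hp0 hp hu hu0]
      simpa [hu0] using Lp.eLpNorm_lt_top ψ
    refine ⟨hφ.toLp, Lp.ext ?_⟩
    filter_upwards [(hmem hφ.toLp).coeFn_toLp, hac.ae_le hφ.coeFn_toLp] with x hx hx'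
    exact hx.trans (by rw [hx', mul_div_cancel_right₀ _ (hu0 x)])
  exact ⟨LinearIsometryEquiv.ofSurjective L hsurj, fun φ => (hmem φ).coeFn_toLp⟩

/-- A measurable function `u` which agrees with `w^(n)` on `f⁻ⁿ(W)` turns `ν` into a measure
with density `‖u‖^p` with respect to `μ`. -/
theorem nuMeas_eq_withDensity {𝕜 X : Type*} [RCLike 𝕜] [MeasurableSpace X] (μ : Measure X)
    (p : ℝ≥0∞) {f : Equiv.Perm X} (w : X → 𝕜) {W : Set X}
    (hmeas : ∀ n : ℤ, MeasurableSet (⇑(f ^ n) ⁻¹' W))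
    (hdisj : Pairwise (Function.onFun Disjoint fun n : ℤ => ⇑(f ^ n) ⁻¹' W))
    (hcover : (⋃ n : ℤ, ⇑(f ^ n) ⁻¹' W) = Set.univ) {u : X → 𝕜}
    (hu : ∀ (n : ℤ), ∀ x ∈ ⇑(f ^ n) ⁻¹' W, u x = wpow f w n x) :
    nuMeas μ p f w W = μ.withDensity fun x => ‖u x‖ₑ ^ p.toReal := by
  rw [← Measure.restrict_univ (μ := μ.withDensity _), ← hcover,
    Measure.restrict_iUnion hdisj hmeas, nuMeas]
  congr 1
  funext n
  rw [restrict_withDensity (hmeas n), restrict_withDensity (hmeas n)]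
  refine withDensity_congr_ae ?_
  filter_upwards [ae_restrict_mem (hmeas n)] with x hx
  rw [hu n x hx, enorm_eq_nnnorm]

/-- **Theorem.** For a dissipative invertible weighted `p`-measurable system `(X,𝔐,μ,f,w)` with
wandering set `W` of finite positive measure, the weighted composition operator `C_{w,f}` on
`L^p(μ)` is conjugate to the unweighted composition operator `C_f` on `L^p(ν)` by means of the
isometric isomorphism `Π(φ) = Σ_{n ∈ ℤ} (φ/w^(n))·χ_{f⁻ⁿ(W)}`. -/
theorem dissipative_weighted_composition_conjugate_to_unweighted
    {𝕜 X : Type*} [RCLike 𝕜] [MeasurableSpace X] (μ : Measure X) [SigmaFinite μ]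
    (hμpos : 0 < μ Set.univ)
    (p : ℝ≥0∞) [Fact (1 ≤ p)] (hp : p ≠ ⊤)
    (f : Equiv.Perm X) (hf : Measurable f) (hf' : Measurable f.symm)
    (hns : ∀ B : Set X, MeasurableSet B → (μ (⇑f ⁻¹' B) = 0 ↔ μ B = 0))
    (w : X → 𝕜) (hw_meas : Measurable w) (hw_bdd : ∃ C : ℝ, ∀ x, ‖w x‖ ≤ C)
    (hc : ∃ c : ℝ≥0∞, 0 < c ∧ ∀ B : Set X, MeasurableSet B →
      (∫⁻ x in B, (‖w x‖₊ : ℝ≥0∞) ^ p.toReal ∂μ) ≤ c * μ (⇑f '' B))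
    (hw0 : ∀ x, w x ≠ 0)
    (hwt_bdd : ∃ C : ℝ, ∀ x, ‖(w (f.symm x))⁻¹‖ ≤ C)
    (hc' : ∃ c : ℝ≥0∞, 0 < c ∧ ∀ B : Set X, MeasurableSet B →
      (∫⁻ x in B, (‖(w (f.symm x))⁻¹‖₊ : ℝ≥0∞) ^ p.toReal ∂μ) ≤ c * μ (⇑f ⁻¹' B))
    -- `W` is a wandering set for `f` with `0 < μ(W) < ∞`
    (W : Set X) (hW : MeasurableSet W)
    (hWdisj : Pairwise (Function.onFun Disjoint fun n : ℤ => ⇑(f ^ n) '' W))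
    (hWcover : (⋃ n : ℤ, ⇑(f ^ n) '' W) = Set.univ)
    (hW0 : 0 < μ W) (hW1 : μ W < ⊤)
    -- `T` is the weighted composition operator `C_{w,f}` on `L^p(μ)`
    (T : Lp 𝕜 p μ ≃L[𝕜] Lp 𝕜 p μ)
    (hT : ∀ φ : Lp 𝕜 p μ, ⇑(T φ) =ᵐ[μ] fun x => w x * φ (f x)) :
    ∃ E : Lp 𝕜 p μ ≃ₗᵢ[𝕜] Lp 𝕜 p (nuMeas μ p f w W),
      (∀ φ : Lp 𝕜 p μ, ⇑(E φ) =ᵐ[nuMeas μ p f w W]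
          fun x => ∑' n : ℤ, Set.indicator (⇑(f ^ n) ⁻¹' W) (fun y => φ y / wpow f w n y) x) ∧
      (∀ φ : Lp 𝕜 p μ, ⇑(E (T φ)) =ᵐ[nuMeas μ p f w W] fun x => (E φ) (f x)) := by
  have himage (n : ℤ) : ⇑(f ^ n) ⁻¹' W = ⇑(f ^ (-n)) '' W := by
    rw [zpow_neg]
    exact ((f ^ n).image_symm_eq_preimage W).symm
  have hmeas (n : ℤ) : MeasurableSet (⇑(f ^ n) ⁻¹' W) :=
    Equiv.Perm.measurable_zpow hf hf' n hW
  have hdisj : Pairwise (Function.onFun Disjoint fun n : ℤ => ⇑(f ^ n) ⁻¹' W) := by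
    intro m n hmn
    simp only [Function.onFun, himage]
    exact hWdisj (neg_injective.ne hmn)
  have hcover : (⋃ n : ℤ, ⇑(f ^ n) ⁻¹' W) = Set.univ := by
    simp only [himage]
    rw [← hWcover]
    exact (Equiv.neg ℤ).iSup_comp (g := fun n : ℤ => ⇑(f ^ n) '' W)
  have hex (x : X) : ∃ n : ℤ, x ∈ ⇑(f ^ n) ⁻¹' W := Set.mem_iUnion.1 (hcover ▸ Set.mem_univ x)
  choose N hN using hex
  have hNuniq {n : ℤ} {x : X} (hx : x ∈ ⇑(f ^ n) ⁻¹' W) : N x = n := by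
    by_contra h
    exact Set.disjoint_left.1 (hdisj h) (hN x) hx
  set u : X → 𝕜 := fun x => wpow f w (N x) x with hu_def
  have hu_eq (n : ℤ) (x : X) (hx : x ∈ ⇑(f ^ n) ⁻¹' W) : u x = wpow f w n x := by
    simp only [hu_def, hNuniq hx]
  have hu0 (x : X) : u x ≠ 0 := wpow_ne_zero f hw0 _ x
  have hu_meas : Measurable u := by
    intro s hs
    have hpre : u ⁻¹' s = ⋃ n : ℤ, ⇑(f ^ n) ⁻¹' W ∩ wpow f w n ⁻¹' s := by
      ext x
      simp only [Set.mem_iUnion, Set.mem_inter_iff]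
      constructor
      · exact fun hx => ⟨N x, hN x, hx⟩
      · rintro ⟨n, hn, hx⟩
        rwa [Set.mem_preimage, hu_eq n x hn]
    rw [hpre]
    exact MeasurableSet.iUnion fun n => (hmeas n).inter (measurable_wpow hf hf' hw_meas n hs)
  have hu_step (x : X) : u x = w x * u (f x) := by
    have hfx : f x ∈ ⇑(f ^ (N x - 1)) ⁻¹' W := by
      rw [Set.mem_preimage, ← Equiv.Perm.mul_apply, ← zpow_add_one, sub_add_cancel]
      exact hN x
    rw [hu_eq _ _ hfx]
    exact wpow_eq_mul_wpow_sub_one f hw0 _ x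
  have hsum (φ : X → 𝕜) (x : X) :
      ∑' n : ℤ, Set.indicator (⇑(f ^ n) ⁻¹' W) (fun y => φ y / wpow f w n y) x
        = φ x / u x := by
    rw [tsum_eq_single (N x) fun n hn =>
      Set.indicator_of_notMem (fun hx => hn (hNuniq hx).symm) _, Set.indicator_of_mem (hN x)]
  simp only [hsum]
  rw [nuMeas_eq_withDensity μ p w hmeas hdisj hcover hu_eq]
  obtain ⟨E, hE⟩ := exists_linearIsometryEquiv_Lp_withDensity μ p hp hu_meas hu0
  refine ⟨E, hE, fun φ => ?_⟩
  set ν := μ.withDensity fun x => ‖u x‖ₑ ^ p.toReal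
  have hac : ν ≪ μ := withDensity_absolutelyContinuous _ _
  have hac' : μ ≪ ν := withDensity_absolutelyContinuous' (hu_meas.enorm.pow_const _).aemeasurable
    (Eventually.of_forall fun x => by simp [hu0 x])
  have hqmp : Measure.QuasiMeasurePreserving f ν ν := by
    refine ⟨hf, Measure.AbsolutelyContinuous.mk fun s hs hs0 => ?_⟩
    rw [Measure.map_apply hf hs]
    exact hac ((hns s hs).2 (hac' hs0))
  filter_upwards [hE (T φ), hac.ae_le (hT φ), hqmp.ae (hE φ)] with x h1 h2 h3
  rw [h1, h2, h3, hu_step x, mul_div_mul_left _ _ (hw0 x)]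
end
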